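/- Let A be a k-algebra with center Z. If Z is strongly detectable, or if Z/N(Z) is strongly detectable, then A is strongly cancellative. -/

import Mathlib

open scoped TensorProduct

universe u

/-- The polynomial extension `A[t₁,…,tₙ]` of a (possibly noncommutative) `k`-algebra `A`
in `n` central, mutually commuting indeterminates. -/
abbrev PolyExt (A : Type u) [Ring A] (n : ℕ) : Type u :=
  AddMonoidAlgebra A (Fin n →₀ ℕ)

/-- The canonical embedding `A → A[t₁,…,tₙ]` as constant polynomials. -/
noncomputable def PolyExt.C (k A : Type u) [Field k] [Ring A] [Algebra k A] (n : ℕ) :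
    A →ₐ[k] PolyExt A n :=
  AddMonoidAlgebra.singleZeroAlgHom

/-- The `i`-th indeterminate of `A[t₁,…,tₙ]`. -/
noncomputable def PolyExt.X (A : Type u) [Ring A] (n : ℕ) (i : Fin n) : PolyExt A n :=
  AddMonoidAlgebra.single (Finsupp.single i 1) 1

/-- Two rings are Morita equivalent if their categories of right modules are
equivalent (as abelian categories). -/
def MoritaEquivalent (R S : Type u) [Ring R] [Ring S] : Prop :=
  Nonempty (ModuleCat.{u} Rᵐᵒᵖ ≌ ModuleCat.{u} Sᵐᵒᵖ)

/-- `A` is strongly cancellative: for every `n ≥ 1` and every `k`-algebra `B`, any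
`k`-algebra isomorphism `A[s₁,…,sₙ] ≅ B[t₁,…,tₙ]` implies `A ≅ B`. -/
def StronglyCancellative (k A : Type u) [Field k] [Ring A] [Algebra k A] : Prop :=
  ∀ (n : ℕ), 1 ≤ n → ∀ (B : Type u) [Ring B] [Algebra k B],
    Nonempty (PolyExt A n ≃ₐ[k] PolyExt B n) → Nonempty (A ≃ₐ[k] B)

/-- `A` is strongly Morita cancellative: for every `n ≥ 1` and every `k`-algebra `B`,
Morita equivalence of `A[s₁,…,sₙ]` and `B[t₁,…,tₙ]` implies Morita equivalence of `A` and `B`. -/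
def StronglyMoritaCancellative (k A : Type u) [Field k] [Ring A] [Algebra k A] : Prop :=
  ∀ (n : ℕ), 1 ≤ n → ∀ (B : Type u) [Ring B] [Algebra k B],
    MoritaEquivalent (PolyExt A n) (PolyExt B n) → MoritaEquivalent A B

/-- `A` is strongly retractable: every `k`-algebra isomorphism
`φ : A[s₁,…,sₙ] → B[t₁,…,tₙ]` (with `n ≥ 1`) satisfies `φ(A) = B`. -/
def StronglyRetractable (k A : Type u) [Field k] [Ring A] [Algebra k A] : Prop :=
  ∀ (n : ℕ), 1 ≤ n → ∀ (B : Type u) [Ring B] [Algebra k B]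
    (φ : PolyExt A n ≃ₐ[k] PolyExt B n),
    φ '' Set.range (PolyExt.C k A n) = Set.range (PolyExt.C k B n)

/-- `A` is strongly detectable: for every `k`-algebra isomorphism
`φ : A[s₁,…,sₙ] → B[t₁,…,tₙ]` (with `n ≥ 1`), the subalgebra of `B[t₁,…,tₙ]` generated by
`B` together with `φ(s₁),…,φ(sₙ)` is all of `B[t₁,…,tₙ]`. -/
def StronglyDetectable (k A : Type u) [Field k] [Ring A] [Algebra k A] : Prop :=
  ∀ (n : ℕ), 1 ≤ n → ∀ (B : Type u) [Ring B] [Algebra k B]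
    (φ : PolyExt A n ≃ₐ[k] PolyExt B n),
    Algebra.adjoin k
      (Set.range (PolyExt.C k B n) ∪ Set.range fun i => φ (PolyExt.X A n i)) = ⊤

theorem RingHom.injective_of_surjective_of_isNoetherianRing {R : Type*} [CommRing R]
    [IsNoetherianRing R] (f : R →+* R) (hf : Function.Surjective f) : Function.Injective f := by
  let F : ℕ →o Ideal R :=
    ⟨fun n => RingHom.ker (f ^ n), monotone_nat_of_le_succ fun n x hx => by
      rw [RingHom.mem_ker, RingHom.coe_pow] at hx ⊢
      rw [Function.iterate_succ_apply', hx, map_zero]⟩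
  obtain ⟨n, hn⟩ := monotone_stabilizes_iff_noetherian.mpr ‹IsNoetherianRing R› F
  rw [injective_iff_map_eq_zero]
  intro x hx
  obtain ⟨y, rfl⟩ := hf.iterate n x
  have hy : y ∈ F (n + 1) := by
    change y ∈ RingHom.ker (f ^ (n + 1))
    rw [RingHom.mem_ker, RingHom.coe_pow, Function.iterate_succ_apply', hx]
  rw [← hn (n + 1) n.le_succ] at hy
  change y ∈ RingHom.ker (f ^ n) at hy
  rwa [RingHom.mem_ker, RingHom.coe_pow] at hy

namespace MvPolynomial

variable {R σ : Type*} [CommRing R]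

/-- A surjective `R`-algebra endomorphism of a polynomial ring in finitely many variables over a
commutative ring is injective. -/
theorem bind₁_injective_of_surjective [Finite σ] (f : σ → MvPolynomial σ R)
    (hf : Function.Surjective (bind₁ f)) : Function.Injective (bind₁ f) := by
  classical
  have := Fintype.ofFinite σ
  rw [injective_iff_map_eq_zero]
  intro h hh
  choose g hg using fun i => hf (X i)
  let s : Finset R := h.coeffs ∪ Finset.univ.biUnion fun i => (f i).coeffs ∪ (g i).coeffs
  let T := Algebra.adjoin ℤ (s : Set R)
  have : Algebra.FiniteType ℤ T := T.fg_iff_finiteType.mp ⟨s, rfl⟩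
  have : IsNoetherianRing T := Algebra.FiniteType.isNoetherianRing ℤ T
  have lift {p : MvPolynomial σ R} (hp : p.coeffs ⊆ s) : ∃ q, map T.val.toRingHom q = p := by
    refine mem_range_map_iff_coeffs_subset.mpr fun a ha => ?_
    exact ⟨⟨a, Algebra.subset_adjoin (hp ha)⟩, rfl⟩
  have hinj : Function.Injective (map (σ := σ) T.val.toRingHom) :=
    map_injective _ Subtype.val_injective
  obtain ⟨h', hh'⟩ := lift (p := h) Finset.subset_union_left
  have hs (i) : (f i).coeffs ∪ (g i).coeffs ⊆ s :=
    (Finset.subset_biUnion_of_mem (fun i => (f i).coeffs ∪ (g i).coeffs)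
      (Finset.mem_univ i)).trans Finset.subset_union_right
  choose f' hf' using fun i => lift (Finset.subset_union_left.trans (hs i))
  choose g' hg' using fun i => lift (Finset.subset_union_right.trans (hs i))
  have key (i) : bind₁ f' (g' i) = X i := by
    apply hinj
    rw [map_bind₁, hg', _root_.funext hf', hg, map_X]
  have hsurj : Function.Surjective (bind₁ f') := by
    intro p
    refine ⟨bind₁ g' p, ?_⟩
    have : (bind₁ f').comp (bind₁ g') = AlgHom.id T _ := by
      ext i : 1
      simp [key]
    exact DFunLike.congr_fun this p
  have := RingHom.injective_of_surjective_of_isNoetherianRing (bind₁ f').toRingHom hsurj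
  rw [← hh', (injective_iff_map_eq_zero _).mp this h', map_zero]
  apply hinj
  rw [map_zero, ← hh, ← hh', ← _root_.funext hf']
  exact map_bind₁ _ _ _

theorem exists_bind₁_eq_X_of_surjective [Finite σ] (f : σ → MvPolynomial σ R)
    (hf : Function.Surjective (bind₁ f)) :
    ∃ g : σ → MvPolynomial σ R, (∀ i, bind₁ f (g i) = X i) ∧ ∀ i, bind₁ g (f i) = X i := by
  choose g hg using fun i => hf (X i)
  refine ⟨g, hg, fun i => bind₁_injective_of_surjective f hf ?_⟩
  have : (bind₁ f).comp (bind₁ g) = AlgHom.id R _ := by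
    ext i : 1
    simp [hg]
  rw [bind₁_X_right]
  exact DFunLike.congr_fun this (f i)

/-- An endomorphism of a polynomial ring in finitely many variables whose image contains every
variable up to a nilpotent is surjective. -/
theorem bind₁_surjective_of_isNilpotent_sub [Finite σ] (f q : σ → MvPolynomial σ R)
    (h : ∀ i, IsNilpotent (X i - bind₁ f (q i))) : Function.Surjective (bind₁ f) := by
  classical
  have := Fintype.ofFinite σ
  let s : Finset R := Finset.univ.biUnion fun i => (X i - bind₁ f (q i)).coeffs
  let I : Ideal R := Ideal.span s
  have hI : IsNilpotent I := by
    rw [Ideal.FG.isNilpotent_iff_le_nilradical ⟨s, rfl⟩, Ideal.span_le]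
    intro a ha
    obtain ⟨i, -, hi⟩ := Finset.mem_biUnion.mp ha
    obtain ⟨m, -, rfl⟩ := mem_coeffs_iff.mp hi
    exact isNilpotent_iff.mp (h i) m
  have hX (i) : X i - bind₁ f (q i) ∈ I.map C := by
    rw [mem_map_C_iff]
    intro m
    by_cases hm : coeff m (X i - bind₁ f (q i)) = 0
    · rw [hm]; exact I.zero_mem
    · exact Ideal.subset_span (Finset.mem_biUnion.mpr
        ⟨i, Finset.mem_univ i, coeff_mem_coeffs _ hm⟩)
  have hone (p : MvPolynomial σ R) : ∃ r, p - bind₁ f r ∈ I.map C := by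
    induction p using MvPolynomial.induction_on with
    | C a => exact ⟨C a, by simp⟩
    | add p p' hp hp' =>
      obtain ⟨r, hr⟩ := hp
      obtain ⟨r', hr'⟩ := hp'
      exact ⟨r + r', by simpa [add_sub_add_comm] using add_mem hr hr'⟩
    | mul_X p i hp =>
      obtain ⟨r, hr⟩ := hp
      refine ⟨r * q i, ?_⟩
      have := add_mem (Ideal.mul_mem_right (X i) _ hr)
        (Ideal.mul_mem_left _ (bind₁ f r) (hX i))
      convert this using 1
      rw [map_mul]
      ring
  have hstep (m : ℕ) (x : MvPolynomial σ R) (hx : x ∈ (I ^ m).map C) :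
      ∀ t, ∃ r, t * x - bind₁ f r ∈ (I ^ (m + 1)).map C := by
    induction hx using Submodule.span_induction with
    | mem x hx =>
      obtain ⟨a, ha, rfl⟩ := hx
      intro t
      obtain ⟨r, hr⟩ := hone t
      refine ⟨r * C a, ?_⟩
      rw [map_mul, bind₁_C_right, ← sub_mul, pow_succ', Ideal.map_mul]
      exact Ideal.mul_mem_mul hr (Ideal.mem_map_of_mem _ ha)
    | zero => exact fun t => ⟨0, by simp⟩
    | add x y _ _ hx hy =>
      intro t
      obtain ⟨r, hr⟩ := hx t
      obtain ⟨r', hr'⟩ := hy t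
      exact ⟨r + r', by simpa [mul_add, add_sub_add_comm] using add_mem hr hr'⟩
    | smul a x _ hx =>
      intro t
      simpa [mul_assoc] using hx (t * a)
  obtain ⟨N, hN⟩ := hI
  have hall (m : ℕ) (p : MvPolynomial σ R) : ∃ r, p - bind₁ f r ∈ (I ^ m).map C := by
    induction m with
    | zero => exact ⟨0, by simp [Ideal.map_top]⟩
    | succ m ih =>
      obtain ⟨r, hr⟩ := ih
      obtain ⟨r', hr'⟩ := hstep m _ hr 1
      exact ⟨r + r', by simpa [sub_sub] using hr'⟩
  intro p
  obtain ⟨r, hr⟩ := hall N p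
  rw [hN, Ideal.zero_eq_bot, Ideal.map_bot, Ideal.mem_bot, sub_eq_zero] at hr
  exact ⟨r, hr.symm⟩

end MvPolynomial

namespace PolyExt

variable {k A B : Type u} [Field k] [Ring A] [Ring B] [Algebra k A] [Algebra k B] {n : ℕ}

lemma C_apply (a : A) : C k A n a = AddMonoidAlgebra.single 0 a := rfl

lemma algHom_ext {R : Type u} [Ring R] [Algebra k R] {φ ψ : PolyExt A n →ₐ[k] R}
    (hC : ∀ a, φ (C k A n a) = ψ (C k A n a)) (hX : ∀ i, φ (X A n i) = ψ (X A n i)) : φ = ψ := by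
  refine AddMonoidAlgebra.algHom_ext' ?_ (AlgHom.ext hC)
  refine Finsupp.mulHom_ext' fun i => MonoidHom.ext_mnat ?_
  exact hX i

/-- Evaluation of polynomials at central elements. -/
noncomputable def eval {R : Type u} [Ring R] [Algebra k R] (g : A →ₐ[k] R)
    (r : Fin n → Subalgebra.center k R) : PolyExt A n →ₐ[k] R :=
  AddMonoidAlgebra.liftNCAlgHom g
    ((((Subalgebra.center k R).val.comp (MvPolynomial.aeval r) :
      MvPolynomial (Fin n) k →ₐ[k] R) : MvPolynomial (Fin n) k →* R).comp
      (MvPolynomial.monomialOneHom k (Fin n)))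
    fun x _ => (Subalgebra.mem_center_iff.mp (Subtype.prop _) (g x))

section

variable {R : Type u} [Ring R] [Algebra k R] (g : A →ₐ[k] R) (r : Fin n → Subalgebra.center k R)

@[simp] lemma eval_C (a : A) : eval g r (C k A n a) = g a := by
  refine (AddMonoidAlgebra.liftNC_single _ _ _ _).trans ?_
  simp

@[simp] lemma eval_X (i : Fin n) : eval g r (X A n i) = r i := by
  refine (AddMonoidAlgebra.liftNC_single _ _ _ _).trans ?_
  rw [AddMonoidHom.coe_coe, map_one, one_mul]
  exact congrArg Subtype.val (MvPolynomial.aeval_X r i)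

end

/-- The inclusion `Z(A)[t₁,…,tₙ] → A[t₁,…,tₙ]`. -/
noncomputable def ofCenter (k A : Type u) [Field k] [Ring A] [Algebra k A] (n : ℕ) :
    PolyExt (Subalgebra.center k A) n →ₐ[k] PolyExt A n :=
  AddMonoidAlgebra.mapAlgHom _ (Subalgebra.center k A).val

@[simp] lemma ofCenter_C (a) : ofCenter k A n (C k _ n a) = C k A n (a : A) := by
  simp [ofCenter, C_apply]

@[simp] lemma ofCenter_X (i) : ofCenter k A n (X _ n i) = X A n i := by
  simp [ofCenter, X]

lemma ofCenter_injective : Function.Injective (ofCenter k A n) := by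
  intro p q h
  refine AddMonoidAlgebra.ext (Finsupp.ext fun m => Subtype.ext ?_)
  simpa [ofCenter] using congrArg (AddMonoidAlgebra.coeff · m) h

lemma range_ofCenter : (ofCenter k A n).range = Subalgebra.center k (PolyExt A n) := by
  ext x
  rw [Subalgebra.mem_center_iff]
  constructor
  · rintro ⟨p, rfl⟩ y
    induction p using AddMonoidAlgebra.induction_linear with
    | zero => simp
    | add p q hp hq => simp_all [mul_add, add_mul]
    | single m a =>
      induction y using AddMonoidAlgebra.induction_linear with
      | zero => simp
      | add p q hp hq => simp_all [mul_add, add_mul]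
      | single m' b =>
        have := Subalgebra.mem_center_iff.mp a.2 b
        simp [ofCenter, AddMonoidAlgebra.single_mul_single, this, add_comm]
  · intro h
    have hc (m) : x.coeff m ∈ Subalgebra.center k A := by
      rw [Subalgebra.mem_center_iff]
      intro a
      have := congrArg (AddMonoidAlgebra.coeff · m) (h (C k A n a))
      rwa [C_apply, AddMonoidAlgebra.coeff_single_zero_mul,
        AddMonoidAlgebra.coeff_mul_single_zero] at this
    have : x ∈ Set.range (AddMonoidAlgebra.map (M := Fin n →₀ ℕ)
          (((Subalgebra.center k A).val : Subalgebra.center k A →+* A) :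
            Subalgebra.center k A →+ A)) := by
      rw [AddMonoidAlgebra.range_map]
      exact fun m => ⟨⟨_, hc m⟩, rfl⟩
    exact this

/-- An isomorphism of polynomial extensions restricts to the polynomial extensions of the
centers. -/
lemma exists_equiv_center (φ : PolyExt A n ≃ₐ[k] PolyExt B n) :
    ∃ ψ : PolyExt (Subalgebra.center k A) n ≃ₐ[k] PolyExt (Subalgebra.center k B) n,
      ∀ p, ofCenter k B n (ψ p) = φ (ofCenter k A n p) := by
  have hmap : (Subalgebra.center k (PolyExt A n)).map (φ : PolyExt A n →ₐ[k] PolyExt B n) =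
      (ofCenter k B n).range := by
    rw [range_ofCenter]
    ext x
    simp only [Subalgebra.mem_map, Subalgebra.mem_center_iff]
    constructor
    · rintro ⟨y, hy, rfl⟩ b
      simpa using congrArg φ (hy (φ.symm b))
    · intro h
      exact ⟨φ.symm x, fun b => φ.injective (by simpa using h (φ b)), by simp⟩
  let e := (((AlgEquiv.ofInjective (ofCenter k A n) ofCenter_injective).trans
    (Subalgebra.equivOfEq _ _ range_ofCenter)).trans
      (φ.subalgebraMap (Subalgebra.center k (PolyExt A n)))).trans (Subalgebra.equivOfEq _ _ hmap)
  refine ⟨e.trans (AlgEquiv.ofInjective (ofCenter k B n) ofCenter_injective).symm, fun p => ?_⟩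
  have := congrArg Subtype.val ((AlgEquiv.ofInjective (ofCenter k B n)
    ofCenter_injective).apply_symm_apply (e p))
  exact this

/-- The value of a polynomial at zero. -/
noncomputable def constCoeff (k A : Type u) [Field k] [Ring A] [Algebra k A] (n : ℕ) :
    PolyExt A n →ₐ[k] A :=
  eval (AlgHom.id k A) 0

@[simp] lemma constCoeff_C (a : A) : constCoeff k A n (C k A n a) = a := by
  simp [constCoeff]

@[simp] lemma constCoeff_X (i : Fin n) : constCoeff k A n (X A n i) = 0 := by
  simp [constCoeff]

lemma constCoeff_comp_of_X (Φ : PolyExt A n →ₐ[k] PolyExt B n) (h : ∀ i, Φ (X A n i) = X B n i)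
    (p : PolyExt A n) :
    constCoeff k B n (Φ (C k A n (constCoeff k A n p))) = constCoeff k B n (Φ p) := by
  have : ((constCoeff k B n).comp Φ).comp ((C k A n).comp (constCoeff k A n)) =
      (constCoeff k B n).comp Φ := algHom_ext (by simp) (by simp [h])
  exact DFunLike.congr_fun this p

/-- An isomorphism of polynomial extensions that respects the indeterminates descends to the
coefficient algebras. -/
lemma nonempty_algEquiv_of_X (Φ : PolyExt A n ≃ₐ[k] PolyExt B n)
    (h : ∀ i, Φ (X A n i) = X B n i) : Nonempty (A ≃ₐ[k] B) := by
  have h' (i) : Φ.symm (X B n i) = X A n i := by simp [← h]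
  refine ⟨AlgEquiv.ofAlgHom
    ((constCoeff k B n).comp ((Φ : PolyExt A n →ₐ[k] PolyExt B n).comp (C k A n)))
    ((constCoeff k A n).comp ((Φ.symm : PolyExt B n →ₐ[k] PolyExt A n).comp (C k B n))) ?_ ?_⟩
  · ext b
    have := constCoeff_comp_of_X (Φ : PolyExt A n →ₐ[k] PolyExt B n) h (Φ.symm (C k B n b))
    simpa using this
  · ext a
    have := constCoeff_comp_of_X (Φ.symm : PolyExt B n →ₐ[k] PolyExt A n) h' (Φ (C k A n a))
    simpa using this

/-- Substitution of central polynomials for the indeterminates. -/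
noncomputable def subst (f : Fin n → PolyExt (Subalgebra.center k B) n) :
    PolyExt B n →ₐ[k] PolyExt B n :=
  eval (C k B n) fun i => ⟨ofCenter k B n (f i), by
    rw [← range_ofCenter]; exact ⟨f i, rfl⟩⟩

lemma subst_ofCenter (f : Fin n → PolyExt (Subalgebra.center k B) n)
    (p : PolyExt (Subalgebra.center k B) n) :
    subst f (ofCenter k B n p) = ofCenter k B n (MvPolynomial.bind₁ f p) := by
  have : (subst f).comp (ofCenter k B n) = (ofCenter k B n).comp
      ((MvPolynomial.bind₁ f).restrictScalars k) := by
    refine algHom_ext (fun a => ?_) fun i => ?_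
    · have : MvPolynomial.bind₁ f (C k _ n a) = C k (Subalgebra.center k B) n a :=
        MvPolynomial.bind₁_C_right f a
      simp [subst, this]
    · have : MvPolynomial.bind₁ f (X _ n i) = f i :=
        MvPolynomial.bind₁_X_right f i
      simp [subst, this]
  exact DFunLike.congr_fun this p

lemma subst_comp_subst {f g : Fin n → PolyExt (Subalgebra.center k B) n}
    (h : ∀ i, MvPolynomial.bind₁ f (g i) = MvPolynomial.X i) :
    (subst f).comp (subst g) = AlgHom.id k (PolyExt B n) := by
  refine algHom_ext (fun a => by simp [subst]) fun i => ?_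
  have : subst g (X B n i) = ofCenter k B n (g i) := by simp [subst]
  rw [AlgHom.comp_apply, this, subst_ofCenter, h]
  exact ofCenter_X i

end PolyExt

namespace PolyExt

variable {k Z W : Type u} [Field k] [CommRing Z] [CommRing W] [Algebra k Z] [Algebra k W] {n : ℕ}

/-- Reduction of the coefficients modulo the nilradical. -/
noncomputable def modNilradical (k Z : Type u) [Field k] [CommRing Z] [Algebra k Z] (n : ℕ) :
    PolyExt Z n →ₐ[k] PolyExt (Z ⧸ nilradical Z) n :=
  AddMonoidAlgebra.mapAlgHom _ (Ideal.Quotient.mkₐ k (nilradical Z))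

@[simp] lemma modNilradical_C (a : Z) :
    modNilradical k Z n (C k Z n a) = C k _ n (Ideal.Quotient.mk (nilradical Z) a) := by
  simp [modNilradical, C_apply]

@[simp] lemma modNilradical_X (i : Fin n) : modNilradical k Z n (X Z n i) = X _ n i := by
  simp [modNilradical, X]

lemma modNilradical_eq_map (p : PolyExt Z n) :
    modNilradical k Z n p = MvPolynomial.map (Ideal.Quotient.mk (nilradical Z)) p := by
  refine AddMonoidAlgebra.ext (Finsupp.ext fun m => ?_)
  have := MvPolynomial.coeff_map (Ideal.Quotient.mk (nilradical Z)) p m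
  exact (AddMonoidAlgebra.coeff_mapAlgHom _ _ _).trans this.symm

lemma modNilradical_surjective : Function.Surjective (modNilradical k Z n) := by
  intro p
  obtain ⟨q, hq⟩ := MvPolynomial.map_surjective (σ := Fin n) (Ideal.Quotient.mk (nilradical Z))
    Ideal.Quotient.mk_surjective p
  exact ⟨q, (modNilradical_eq_map q).trans hq⟩

lemma isNilpotent_of_modNilradical_eq_zero {p : PolyExt Z n} (h : modNilradical k Z n p = 0) :
    IsNilpotent p := by
  refine MvPolynomial.isNilpotent_iff.mpr fun m => ?_
  rw [modNilradical_eq_map] at h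
  rw [← mem_nilradical, ← Ideal.Quotient.eq_zero_iff_mem, ← MvPolynomial.coeff_map, h,
    MvPolynomial.coeff_zero]

lemma exists_reduction (ψ : PolyExt Z n →ₐ[k] PolyExt W n) :
    ∃ ψ' : PolyExt (Z ⧸ nilradical Z) n →ₐ[k] PolyExt (W ⧸ nilradical W) n,
      ∀ p, ψ' (modNilradical k Z n p) = modNilradical k W n (ψ p) := by
  have : IsReduced (W ⧸ nilradical W) :=
    (Ideal.isRadical_iff_quotient_reduced _).mp (Ideal.radical_isRadical _)
  have : IsReduced (PolyExt (W ⧸ nilradical W) n) :=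
    inferInstanceAs (IsReduced (MvPolynomial (Fin n) (W ⧸ nilradical W)))
  let g : Z ⧸ nilradical Z →ₐ[k] PolyExt (W ⧸ nilradical W) n :=
    Ideal.Quotient.liftₐ (nilradical Z) (((modNilradical k W n).comp ψ).comp (C k Z n))
      fun a ha => ((mem_nilradical.mp ha).map _).eq_zero
  refine ⟨eval g fun i => ⟨modNilradical k W n (ψ (X Z n i)),
    Subalgebra.mem_center_iff.mpr fun b => mul_comm _ _⟩, fun p => ?_⟩
  refine DFunLike.congr_fun (f := (eval g _).comp (modNilradical k Z n))
    (g := (modNilradical k W n).comp ψ) (algHom_ext (fun a => ?_) fun i => ?_) p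
  · simp only [AlgHom.comp_apply, modNilradical_C, eval_C]
    rfl
  · simp

/-- An isomorphism of polynomial extensions induces one modulo nilradicals. -/
lemma exists_reduction_equiv (ψ : PolyExt Z n ≃ₐ[k] PolyExt W n) :
    ∃ ψ' : PolyExt (Z ⧸ nilradical Z) n ≃ₐ[k] PolyExt (W ⧸ nilradical W) n,
      ∀ p, ψ' (modNilradical k Z n p) = modNilradical k W n (ψ p) := by
  obtain ⟨f, hf⟩ := exists_reduction (ψ : PolyExt Z n →ₐ[k] PolyExt W n)
  obtain ⟨g, hg⟩ := exists_reduction (ψ.symm : PolyExt W n →ₐ[k] PolyExt Z n)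
  refine ⟨AlgEquiv.ofAlgHom f g (AlgHom.ext fun p => ?_) (AlgHom.ext fun p => ?_), hf⟩
  · obtain ⟨p, rfl⟩ := modNilradical_surjective (k := k) p
    simp [hf, hg]
  · obtain ⟨p, rfl⟩ := modNilradical_surjective (k := k) p
    simp [hf, hg]

lemma bind₁_surjective_of_adjoin_eq_top (f : Fin n → PolyExt W n)
    (h : Algebra.adjoin k (Set.range (C k W n) ∪ Set.range f) = ⊤) :
    Function.Surjective (MvPolynomial.bind₁ f) := by
  have : (⊤ : Subalgebra k (PolyExt W n)) ≤
      ((MvPolynomial.bind₁ f).restrictScalars k).range := by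
    rw [← h, Algebra.adjoin_le_iff]
    rintro _ (⟨a, rfl⟩ | ⟨i, rfl⟩)
    · exact ⟨MvPolynomial.C a, MvPolynomial.bind₁_C_right f a⟩
    · exact ⟨MvPolynomial.X i, MvPolynomial.bind₁_X_right f i⟩
  exact fun p => this (Algebra.mem_top (R := k) (x := p))

lemma bind₁_surjective_of_stronglyDetectable
    (h : StronglyDetectable k Z ∨ StronglyDetectable k (Z ⧸ nilradical Z)) (hn : 1 ≤ n)
    (ψ : PolyExt Z n ≃ₐ[k] PolyExt W n) :
    Function.Surjective (MvPolynomial.bind₁ fun i => ψ (X Z n i)) := by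
  obtain h | h := h
  · exact bind₁_surjective_of_adjoin_eq_top _ (h n hn W ψ)
  obtain ⟨ψ', hψ'⟩ := exists_reduction_equiv ψ
  have hsurj := bind₁_surjective_of_adjoin_eq_top _ (h n hn _ ψ')
  have hX (i) : ψ' (X _ n i) = MvPolynomial.map (Ideal.Quotient.mk (nilradical W))
      (ψ (X Z n i)) := by
    rw [← modNilradical_X (k := k), hψ', modNilradical_eq_map]
  simp only [hX] at hsurj
  choose q' hq' using fun i => hsurj (MvPolynomial.X i)
  choose q hq using fun i => MvPolynomial.map_surjective
    (Ideal.Quotient.mk (nilradical W)) Ideal.Quotient.mk_surjective (q' i)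
  refine MvPolynomial.bind₁_surjective_of_isNilpotent_sub _ q fun i => ?_
  refine isNilpotent_of_modNilradical_eq_zero (k := k) ?_
  rw [modNilradical_eq_map, map_sub, MvPolynomial.map_X, MvPolynomial.map_bind₁, hq, hq', sub_self]

end PolyExt

/-- If the center `Z` of `A`, or `Z/N(Z)`, is strongly detectable,
then `A` is strongly cancellative. -/
theorem strongly_cancellative_of_center_strongly_detectable
    (k A : Type u) [Field k] [Ring A] [Algebra k A]
    (h : StronglyDetectable k (Subalgebra.center k A) ∨
      StronglyDetectable k
        ((Subalgebra.center k A) ⧸ nilradical (Subalgebra.center k A))) :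
    StronglyCancellative k A := by
  rintro n hn B _ _ ⟨φ⟩
  obtain ⟨ψ, hψ⟩ := PolyExt.exists_equiv_center φ
  obtain ⟨g, hfg, hgf⟩ := MvPolynomial.exists_bind₁_eq_X_of_surjective _
    (PolyExt.bind₁_surjective_of_stronglyDetectable h hn ψ)
  let Θ := AlgEquiv.ofAlgHom (PolyExt.subst g) (PolyExt.subst fun i => ψ (PolyExt.X _ n i))
    (PolyExt.subst_comp_subst hgf) (PolyExt.subst_comp_subst hfg)
  refine PolyExt.nonempty_algEquiv_of_X (φ.trans Θ) fun i => ?_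
  rw [AlgEquiv.trans_apply, ← PolyExt.ofCenter_X (k := k), ← hψ]
  refine (PolyExt.subst_ofCenter g _).trans ?_
  exact (congrArg (PolyExt.ofCenter k B n) (hgf i)).trans (PolyExt.ofCenter_X i)
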